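/- (Theorem 1) The average age of information equals Δ̄ = 1 + E[Ỹ²]/(2·E[Ỹ]) = 3/2 + (Σ_{j=0}^∞ j·ξ_j)/(Σ_{j=0}^∞ ξ_j), where E[Ỹ] = Σ_{m=1}^∞ m·ξ_{m-1}·(1 − ε_{m-1}) and E[Ỹ²] = Σ_{m=1}^∞ m²·ξ_{m-1}·(1 − ε_{m-1}). -/

import Mathlib

theorem Summable.hasSum_sub_succ {a : ℕ → ℝ} (ha : Summable a) :
    HasSum (fun j => a j - a (j + 1)) (a 0) := by
  have hshift := (summable_nat_add_iff 1).2 ha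
  have h := ha.hasSum.sub hshift.hasSum
  rwa [ha.tsum_eq_zero_add, add_sub_cancel_right] at h

theorem summable_pow_mul_prod_range {ε : ℕ → ℝ} {c : ℝ}
    (hε_nonneg : ∀ m, 0 ≤ ε m) (hε_le : ∀ m, ε m ≤ c)
    (hc_nonneg : 0 ≤ c) (hc_lt : c < 1) (k : ℕ) :
    Summable fun j : ℕ => (j : ℝ) ^ k * ∏ m ∈ Finset.range j, ε m := by
  have hgeom : Summable fun j : ℕ => (j : ℝ) ^ k * c ^ j :=
    summable_pow_mul_geometric_of_norm_lt_one k (by rwa [Real.norm_of_nonneg hc_nonneg])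
  refine Summable.of_nonneg_of_le
    (fun j => mul_nonneg (by positivity) (Finset.prod_nonneg fun m _ => hε_nonneg m))
    (fun j => mul_le_mul_of_nonneg_left ?_ (by positivity)) hgeom
  calc ∏ m ∈ Finset.range j, ε m ≤ ∏ _m ∈ Finset.range j, c :=
        Finset.prod_le_prod (fun m _ => hε_nonneg m) fun m _ => hε_le m
    _ = c ^ j := by simp

/-- (Theorem 1) The average age of information equals
`Δ̄ = 1 + E[Ỹ²]/(2 E[Ỹ]) = 3/2 + (Σ_j j ξ_j)/(Σ_j ξ_j)`, where
`E[Ỹ] = Σ_{m=1}^∞ m ξ_{m-1} (1 - ε_{m-1})` and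
`E[Ỹ²] = Σ_{m=1}^∞ m² ξ_{m-1} (1 - ε_{m-1})` (reindexed with `m = j + 1`). -/
theorem average_aoi_formula
    (ε : ℕ → ℝ) (c : ℝ)
    (hε_nonneg : ∀ m, 0 ≤ ε m) (hε_le : ∀ m, ε m ≤ c)
    (hc_nonneg : 0 ≤ c) (hc_lt : c < 1)
    (ξ : ℕ → ℝ) (hξ : ∀ j, ξ j = ∏ m ∈ Finset.range j, ε m)
    (EY EY2 : ℝ)
    (hEY : EY = ∑' j : ℕ, ((j : ℝ) + 1) * (ξ j * (1 - ε j)))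
    (hEY2 : EY2 = ∑' j : ℕ, ((j : ℝ) + 1) ^ 2 * (ξ j * (1 - ε j))) :
    1 + EY2 / (2 * EY) = 3 / 2 + (∑' j : ℕ, (j : ℝ) * ξ j) / (∑' j : ℕ, ξ j) := by
  have hsummable (k : ℕ) : Summable fun j : ℕ => (j : ℝ) ^ k * ξ j := by
    simpa only [hξ] using summable_pow_mul_prod_range hε_nonneg hε_le hc_nonneg hc_lt k
  have hsucc (j : ℕ) : ξ (j + 1) = ξ j * ε j := by
    rw [hξ, hξ, Finset.prod_range_succ]
  have hξ_nonneg (j : ℕ) : 0 ≤ ξ j := by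
    rw [hξ]
    exact Finset.prod_nonneg fun m _ => hε_nonneg m
  have h0 : Summable ξ := by simpa using hsummable 0
  have h1 : Summable fun j : ℕ => (j : ℝ) * ξ j := by simpa using hsummable 1
  have hpos : 0 < ∑' j, ξ j := h0.tsum_pos hξ_nonneg 0 (by simp [hξ])
  have hmean : EY = ∑' j, ξ j := by
    have h := h0.hasSum.add h1.hasSum_sub_succ
    simp only [Nat.cast_zero, zero_mul, add_zero] at h
    rw [hEY, ← h.tsum_eq]
    refine tsum_congr fun j => ?_
    rw [hsucc]
    push_cast
    ring
  have hsecond : EY2 = 2 * ∑' j : ℕ, (j : ℝ) * ξ j + ∑' j, ξ j := by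
    have h := ((h1.hasSum.mul_left 2).add h0.hasSum).add (hsummable 2).hasSum_sub_succ
    simp only [Nat.cast_zero, zero_mul, add_zero, ne_eq, OfNat.ofNat_ne_zero,
      not_false_eq_true, zero_pow] at h
    rw [hEY2, ← h.tsum_eq]
    refine tsum_congr fun j => ?_
    rw [hsucc]
    push_cast
    ring
  rw [hmean, hsecond]
  field_simp
  ring
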